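/- Let p ∈ [1,∞], let ε ≥ 0, let β ∈ ℝⁿ, let F₀ be a Borel probability distribution on Ξ = {−1,1}×ℝⁿ with finite p-th moment, and let (Y₀,X₀) ∼ F₀. Then the set of distributions on ℝ given by { law of Y·β^⊤X : the law of (Y,X) lies in B̄_p(F₀,ε) } is equal to the type-p Wasserstein ball (with the absolute-value norm on ℝ) B_p(law of Y₀·β^⊤X₀, ε‖β‖_*), where ‖β‖_* = sup_{‖x‖≤1} β^⊤x is the dual norm. -/

import Mathlib

open MeasureTheory Set
open scoped ENNReal NNReal

noncomputable section

abbrev Vec (n : ℕ) := Fin n → ℝ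

/-- `β^⊤x` -/
def dotp {n : ℕ} (β x : Vec n) : ℝ := ∑ i, β i * x i

/-- `nrm` is a norm on `ℝⁿ`. -/
def IsNorm {n : ℕ} (nrm : Vec n → ℝ) : Prop :=
  (∀ x, nrm x = 0 ↔ x = 0) ∧
  (∀ (c : ℝ) (x : Vec n), nrm (c • x) = |c| * nrm x) ∧
  (∀ x y : Vec n, nrm (x + y) ≤ nrm x + nrm y)

/-- the dual norm `‖β‖_* = sup_{‖x‖ ≤ 1} β^⊤x`. -/
def dualNorm {n : ℕ} (nrm : Vec n → ℝ) (β : Vec n) : ℝ :=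
  sSup {r | ∃ x, nrm x ≤ 1 ∧ r = dotp β x}

/-- Couplings of two probability measures. -/
def Couplings {E : Type*} [MeasurableSpace E] (μ ν : Measure E) : Set (Measure (E × E)) :=
  {π | IsProbabilityMeasure π ∧ π.map Prod.fst = μ ∧ π.map Prod.snd = ν}

/-- The type-`p` Wasserstein distance (valued in `ℝ≥0∞`) associated with an
extended-real-valued cost; for `p = ∞` it is the infimum over couplings of the essential
supremum of the cost. -/
def WassersteinD {E : Type*} [MeasurableSpace E] (cost : E → E → ℝ≥0∞) (p : ℝ≥0∞)
    (μ ν : Measure E) : ℝ≥0∞ :=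
  if p = ∞ then ⨅ π ∈ Couplings μ ν, essSup (fun z : E × E => cost z.1 z.2) π
  else ⨅ π ∈ Couplings μ ν, (∫⁻ z, cost z.1 z.2 ^ p.toReal ∂π) ^ (1 / p.toReal)

/-- Finite `p`-th moment (with respect to a "norm-like" function `nrm`);
for `p = ∞` it means essential boundedness. -/
def HasMomentP {E : Type*} [MeasurableSpace E] (nrm : E → ℝ) (p : ℝ≥0∞) (μ : Measure E) : Prop :=
  if p = ∞ then essSup (fun x => ENNReal.ofReal (nrm x)) μ ≠ ∞
  else ∫⁻ x, ENNReal.ofReal (nrm x) ^ p.toReal ∂μ ≠ ∞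

/-- The type-`p` Wasserstein ball of probability distributions on `ℝⁿ` (norm `nrm`). -/
def WballVec {n : ℕ} (nrm : Vec n → ℝ) (p : ℝ≥0∞) (μ₀ : Measure (Vec n)) (ε : ℝ) :
    Set (Measure (Vec n)) :=
  {μ | IsProbabilityMeasure μ ∧ HasMomentP nrm p μ ∧
    WassersteinD (fun x y => ENNReal.ofReal (nrm (x - y))) p μ μ₀ ≤ ENNReal.ofReal ε}

/-- The type-`p` Wasserstein ball of probability distributions on `ℝ`
(absolute-value norm). -/
def WballReal (p : ℝ≥0∞) (μ₀ : Measure ℝ) (ε : ℝ) : Set (Measure ℝ) :=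
  {μ | IsProbabilityMeasure μ ∧ HasMomentP (fun x : ℝ => |x|) p μ ∧
    WassersteinD (fun x y : ℝ => ENNReal.ofReal |x - y|) p μ μ₀ ≤ ENNReal.ofReal ε}

/-- The metric on `Ξ = {-1,1} × ℝⁿ`:
`d((y₁,x₁),(y₂,x₂)) = ‖x₁ - x₂‖` if `y₁ = y₂`, and `+∞` otherwise. -/
def xiCost {n : ℕ} (nrm : Vec n → ℝ) (z₁ z₂ : ℝ × Vec n) : ℝ≥0∞ :=
  if z₁.1 = z₂.1 then ENNReal.ofReal (nrm (z₁.2 - z₂.2)) else ∞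

/-- A measure on `ℝ × ℝⁿ` is concentrated on `Ξ = {-1,1} × ℝⁿ`. -/
def OnXi {n : ℕ} (μ : Measure (ℝ × Vec n)) : Prop :=
  μ {z | z.1 = 1 ∨ z.1 = -1} = 1

/-- The type-`p` Wasserstein ball `B̄_p(F₀,ε)` of probability distributions on
`Ξ = {-1,1} × ℝⁿ`. -/
def WballXi {n : ℕ} (nrm : Vec n → ℝ) (p : ℝ≥0∞) (μ₀ : Measure (ℝ × Vec n)) (ε : ℝ) :
    Set (Measure (ℝ × Vec n)) :=
  {μ | IsProbabilityMeasure μ ∧ OnXi μ ∧ HasMomentP (fun z => nrm z.2) p μ ∧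
    WassersteinD (xiCost nrm) p μ μ₀ ≤ ENNReal.ofReal ε}

lemma WassersteinD_eq_iInf_eLpNorm {X : Type*} [MeasurableSpace X] (cost : X → X → ℝ≥0∞)
    {p : ℝ≥0∞} (hp : p ≠ 0) (μ ν : Measure X) :
    WassersteinD cost p μ ν =
      ⨅ π ∈ Couplings μ ν, eLpNorm (fun z : X × X => cost z.1 z.2) p π := by
  unfold WassersteinD
  split_ifs with h
  · subst h
    simp [eLpNormEssSup]
  · simp [eLpNorm_eq_lintegral_rpow_enorm_toReal hp h]

lemma hasMomentP_iff {X : Type*} [MeasurableSpace X] (g : X → ℝ) {p : ℝ≥0∞} (hp : p ≠ 0)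
    (μ : Measure X) :
    HasMomentP g p μ ↔ eLpNorm (fun x => ENNReal.ofReal (g x)) p μ ≠ ∞ := by
  unfold HasMomentP
  split_ifs with h
  · subst h
    simp [eLpNormEssSup]
  · have hpos : 0 < p.toReal := ENNReal.toReal_pos hp h
    simp only [eLpNorm_eq_lintegral_rpow_enorm_toReal hp h, enorm_eq_self]
    rw [not_iff_not, ENNReal.rpow_eq_top_iff_of_pos (by positivity)]

lemma prod_mem_couplings {X : Type*} [MeasurableSpace X] (μ ν : Measure X)
    [IsProbabilityMeasure μ] [IsProbabilityMeasure ν] :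
    μ.prod ν ∈ Couplings μ ν :=
  ⟨inferInstance, by simp, by simp⟩

section Transport

variable {X : Type*} [MeasurableSpace X] [TopologicalSpace X]

/-- Integration of a nonnegative continuous function is lower semicontinuous for the weak
topology on probability measures. -/
lemma lowerSemicontinuous_lintegral_nnreal [OpensMeasurableSpace X] {f : X → ℝ≥0}
    (hf : Continuous f) :
    LowerSemicontinuous (fun μ : ProbabilityMeasure X => ∫⁻ x, (f x : ℝ≥0∞) ∂(μ : Measure X)) := by
  have key : (fun μ : ProbabilityMeasure X => ∫⁻ x, (f x : ℝ≥0∞) ∂(μ : Measure X)) =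
      fun μ : ProbabilityMeasure X =>
        ⨆ N : ℕ, ∫⁻ x, ((min (f x) N : ℝ≥0) : ℝ≥0∞) ∂(μ : Measure X) := by
    funext μ
    rw [← lintegral_iSup]
    · congr 1 with x
      refine le_antisymm ?_ (iSup_le fun N => by exact_mod_cast min_le_left _ _)
      obtain ⟨N, hN⟩ := exists_nat_ge (f x)
      exact le_iSup_of_le N (by rw [min_eq_left hN])
    · intro N
      exact (hf.min continuous_const).measurable.coe_nnreal_ennreal
    · intro N M hNM x
      have : (N : ℝ≥0) ≤ M := by exact_mod_cast hNM
      exact ENNReal.coe_le_coe.2 (min_le_min_left _ this)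
  rw [key]
  refine lowerSemicontinuous_iSup fun N => Continuous.lowerSemicontinuous ?_
  have hb : ∀ x y, dist (min (f x) (N : ℝ≥0)) (min (f y) (N : ℝ≥0)) ≤ N := by
    intro x y
    have hx : ((min (f x) (N : ℝ≥0) : ℝ≥0) : ℝ) ≤ N := by exact_mod_cast min_le_right _ _
    have hy : ((min (f y) (N : ℝ≥0) : ℝ≥0) : ℝ) ≤ N := by exact_mod_cast min_le_right _ _
    have hx0 := (min (f x) (N : ℝ≥0)).coe_nonneg
    have hy0 := (min (f y) (N : ℝ≥0)).coe_nonneg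
    rw [NNReal.dist_eq, abs_le]
    constructor <;> linarith
  exact ProbabilityMeasure.continuous_lintegral_boundedContinuousFunction
    (BoundedContinuousFunction.mkOfBound ⟨fun x => min (f x) (N : ℝ≥0), by fun_prop⟩ N hb)

/-- `L^p` seminorms of a continuous function are lower semicontinuous for the weak topology on
probability measures. -/
lemma lowerSemicontinuous_eLpNorm [OpensMeasurableSpace X] {f : X → ℝ≥0} (hf : Continuous f)
    (p : ℝ≥0∞) :
    LowerSemicontinuous
      (fun μ : ProbabilityMeasure X => eLpNorm (fun x => (f x : ℝ≥0∞)) p (μ : Measure X)) := by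
  rcases eq_or_ne p 0 with rfl | hp0
  · simpa using! lowerSemicontinuous_const
  rcases eq_or_ne p ∞ with rfl | hp
  · rw [lowerSemicontinuous_iff_isClosed_preimage]
    intro a
    induction a with
    | top => simp
    | coe a =>
      have hset : (fun μ : ProbabilityMeasure X =>
            eLpNorm (fun x => (f x : ℝ≥0∞)) ∞ (μ : Measure X)) ⁻¹' Iic (a : ℝ≥0∞) =
          (fun μ : ProbabilityMeasure X =>
            ∫⁻ x, ((f x - a : ℝ≥0) : ℝ≥0∞) ∂(μ : Measure X)) ⁻¹' Iic 0 := by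
        ext μ
        simp only [mem_preimage, mem_Iic, nonpos_iff_eq_zero, eLpNorm_exponent_top]
        have hm : Measurable fun x => ((f x - a : ℝ≥0) : ℝ≥0∞) :=
          (hf.sub continuous_const).measurable.coe_nnreal_ennreal
        rw [lintegral_eq_zero_iff hm]
        have h1 : eLpNormEssSup (fun x => (f x : ℝ≥0∞)) (μ : Measure X) ≤ a ↔
            ∀ᵐ x ∂(μ : Measure X), (f x : ℝ≥0∞) ≤ a := by
          constructor
          · intro h
            filter_upwards [ae_le_eLpNormEssSup (f := fun x => (f x : ℝ≥0∞))] with x hx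
            exact (by simpa using hx : (f x : ℝ≥0∞) ≤ _).trans h
          · intro h
            exact essSup_le_of_ae_le _ (by filter_upwards [h] with x hx; simpa using hx)
        rw [h1]
        refine Filter.eventually_congr (.of_forall fun x => ?_)
        simp only [Pi.zero_apply, ENNReal.coe_eq_zero, tsub_eq_zero_iff_le, ENNReal.coe_le_coe]
      rw [hset]
      exact (lowerSemicontinuous_lintegral_nnreal (hf.sub continuous_const)).isClosed_preimage 0
  · have hpos : 0 < p.toReal := ENNReal.toReal_pos hp0 hp
    have h := lowerSemicontinuous_lintegral_nnreal
      ((NNReal.continuous_rpow_const hpos.le).comp hf)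
    have := (ENNReal.continuous_rpow_const (y := 1 / p.toReal)).comp_lowerSemicontinuous h
      (ENNReal.monotone_rpow_of_nonneg (by positivity))
    convert! this using 2 with μ
    simp [eLpNorm_eq_lintegral_rpow_enorm_toReal hp0 hp, ENNReal.coe_rpow_of_nonneg _ hpos.le]

lemma isCompact_couplings [PolishSpace X] [BorelSpace X] (μ ν : Measure X)
    [IsProbabilityMeasure μ] [IsProbabilityMeasure ν] :
    IsCompact {π : ProbabilityMeasure (X × X) | (π : Measure (X × X)) ∈ Couplings μ ν} := by
  have hclosed :
      IsClosed {π : ProbabilityMeasure (X × X) | (π : Measure (X × X)) ∈ Couplings μ ν} := by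
    let μ' : ProbabilityMeasure X := ⟨μ, inferInstance⟩
    let ν' : ProbabilityMeasure X := ⟨ν, inferInstance⟩
    have heq : {π : ProbabilityMeasure (X × X) | (π : Measure (X × X)) ∈ Couplings μ ν} =
        {π | π.map (f := Prod.fst) measurable_fst.aemeasurable = μ'} ∩
        {π | π.map (f := Prod.snd) measurable_snd.aemeasurable = ν'} := by
      ext π
      change (_ ∧ _ ∧ _) ↔ (π.map (f := Prod.fst) measurable_fst.aemeasurable = μ' ∧
        π.map (f := Prod.snd) measurable_snd.aemeasurable = ν')
      rw [← ProbabilityMeasure.toMeasure_injective.eq_iff,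
        ← ProbabilityMeasure.toMeasure_injective.eq_iff]
      exact ⟨fun h => h.2, fun h => ⟨π.2, h⟩⟩
    rw [heq]
    exact (isClosed_eq (ProbabilityMeasure.continuous_map continuous_fst) continuous_const).inter
      (isClosed_eq (ProbabilityMeasure.continuous_map continuous_snd) continuous_const)
  rw [← hclosed.closure_eq]
  apply isCompact_closure_of_isTightMeasureSet
  apply IsTightMeasureSet.prodMk
  · refine (isTightMeasureSet_singleton (μ := μ)).subset ?_
    rintro _ ⟨_, ⟨π, hπ, rfl⟩, rfl⟩
    exact hπ.2.1
  · refine (isTightMeasureSet_singleton (μ := ν)).subset ?_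
    rintro _ ⟨_, ⟨π, hπ, rfl⟩, rfl⟩
    exact hπ.2.2

/-- Existence of optimal couplings for continuous finite costs on a Polish space. -/
lemma exists_optimal_coupling [PolishSpace X] [BorelSpace X] {c : X × X → ℝ≥0}
    (hc : Continuous c) {p : ℝ≥0∞} (hp : p ≠ 0) (μ ν : Measure X)
    [IsProbabilityMeasure μ] [IsProbabilityMeasure ν] :
    ∃ π ∈ Couplings μ ν, eLpNorm (fun z => (c z : ℝ≥0∞)) p π =
      WassersteinD (fun x y => (c (x, y) : ℝ≥0∞)) p μ ν := by
  obtain ⟨π, hπ, hmin⟩ := LowerSemicontinuousOn.exists_isMinOn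
    ⟨⟨μ.prod ν, inferInstance⟩, prod_mem_couplings μ ν⟩ (isCompact_couplings μ ν)
    ((lowerSemicontinuous_eLpNorm hc p).lowerSemicontinuousOn _)
  refine ⟨π, hπ, ?_⟩
  rw [WassersteinD_eq_iInf_eLpNorm _ hp]
  refine le_antisymm (le_iInf₂ fun π' hπ' => ?_) (iInf₂_le (π : Measure (X × X)) hπ)
  exact hmin (a := ⟨π', hπ'.1⟩) hπ'

end Transport

/-- Gluing: a coupling of `μ` with the push-forward of `F` along `T` lifts to a coupling of
`μ` with `F`. -/
lemma exists_lift_coupling {Ω E E' : Type*} [MeasurableSpace Ω] [MeasurableSpace E]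
    [MeasurableSpace E'] [StandardBorelSpace E] [Nonempty E] {T : Ω → E'} (hT : Measurable T)
    (F : Measure Ω) [IsProbabilityMeasure F] (π : Measure (E × E')) [IsProbabilityMeasure π]
    (hπ : π.map Prod.snd = F.map T) :
    ∃ ρ : Measure (Ω × E), IsProbabilityMeasure ρ ∧ ρ.map Prod.fst = F ∧
      ρ.map (fun w => (w.2, T w.1)) = π := by
  set σ : Measure (E' × E) := π.map Prod.swap with hσ
  have : IsProbabilityMeasure σ := Measure.isProbabilityMeasure_map measurable_swap.aemeasurable
  have hfst : σ.fst = F.map T := by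
    rw [← hπ, Measure.fst, hσ, Measure.map_map measurable_fst measurable_swap]
    rfl
  refine ⟨F.compProd (σ.condKernel.comap T hT), inferInstance, Measure.fst_compProd _ _, ?_⟩
  have h : (F.compProd (σ.condKernel.comap T hT)).map (fun w => (T w.1, w.2)) = σ := by
    conv_rhs => rw [← σ.disintegrate σ.condKernel, hfst]
    ext s hs
    rw [Measure.map_apply (by fun_prop) hs, Measure.compProd_apply (by measurability),
      Measure.compProd_apply hs,
      lintegral_map (ProbabilityTheory.Kernel.measurable_kernel_prodMk_left hs) hT]
    rfl
  calc (F.compProd (σ.condKernel.comap T hT)).map (fun w => (w.2, T w.1))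
      = ((F.compProd (σ.condKernel.comap T hT)).map (fun w => (T w.1, w.2))).map Prod.swap := by
        rw [Measure.map_map measurable_swap (by fun_prop)]
        rfl
    _ = π := by
        rw [h, hσ, Measure.map_map measurable_swap measurable_swap]
        simp

section Norm

variable {n : ℕ} {nrm : Vec n → ℝ}

lemma dotp_add (β x y : Vec n) : dotp β (x + y) = dotp β x + dotp β y := by
  simp [dotp, mul_add, Finset.sum_add_distrib]

lemma dotp_smul (β : Vec n) (c : ℝ) (x : Vec n) : dotp β (c • x) = c * dotp β x := by
  simp only [dotp, Pi.smul_apply, smul_eq_mul, Finset.mul_sum]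
  exact Finset.sum_congr rfl fun i _ => by ring

lemma dotp_sub (β x y : Vec n) : dotp β (x - y) = dotp β x - dotp β y := by
  simp [dotp, mul_sub, Finset.sum_sub_distrib]

lemma dotp_zero (β : Vec n) : dotp β 0 = 0 := by
  simp [dotp]

lemma continuous_dotp (β : Vec n) : Continuous (dotp β) := by
  unfold dotp
  fun_prop

lemma IsNorm.zero (h : IsNorm nrm) : nrm 0 = 0 := (h.1 0).2 rfl

lemma IsNorm.neg (h : IsNorm nrm) (x : Vec n) : nrm (-x) = nrm x := by
  have := h.2.1 (-1) x
  simpa using this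

lemma IsNorm.nonneg (h : IsNorm nrm) (x : Vec n) : 0 ≤ nrm x := by
  have := h.2.2 x (-x)
  rw [h.neg, add_neg_cancel, h.zero] at this
  linarith

lemma IsNorm.exists_le_mul_norm (h : IsNorm nrm) : ∃ C, ∀ x, nrm x ≤ C * ‖x‖ := by
  refine ⟨∑ i, nrm (Pi.single i 1), fun x => ?_⟩
  have hsum : ∀ s : Finset (Fin n),
      nrm (∑ i ∈ s, x i • Pi.single i 1) ≤ ∑ i ∈ s, |x i| * nrm (Pi.single i 1) := by
    intro s
    induction s using Finset.induction_on with
    | empty => simp [h.zero]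
    | insert a s ha ih =>
      rw [Finset.sum_insert ha, Finset.sum_insert ha]
      refine (h.2.2 _ _).trans ?_
      rw [h.2.1]
      linarith
  have hx : x = ∑ i, x i • (Pi.single i 1 : Vec n) := by
    ext j
    simp [Finset.sum_apply, Pi.single_apply]
  calc nrm x = nrm (∑ i, x i • (Pi.single i 1 : Vec n)) := by rw [← hx]
    _ ≤ ∑ i, |x i| * nrm (Pi.single i 1) := hsum _
    _ ≤ ∑ i, ‖x‖ * nrm (Pi.single i 1) := by
        gcongr with i
        · exact h.nonneg _
        · exact norm_le_pi_norm x i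
    _ = _ := by rw [← Finset.mul_sum, mul_comm]

lemma IsNorm.continuous (h : IsNorm nrm) : Continuous nrm := by
  obtain ⟨C, hC⟩ := h.exists_le_mul_norm
  refine (LipschitzWith.of_le_add_mul C.toNNReal fun x y => ?_).continuous
  have h1 := h.2.2 y (x - y)
  rw [add_sub_cancel] at h1
  have h2 := hC (x - y)
  have h3 : C * ‖x - y‖ ≤ C.toNNReal * dist x y := by
    rw [dist_eq_norm]
    gcongr
    exact Real.le_coe_toNNReal C
  linarith

lemma IsNorm.exists_mul_norm_le (h : IsNorm nrm) : ∃ m > 0, ∀ x, m * ‖x‖ ≤ nrm x := by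
  by_cases hne : (Metric.sphere (0 : Vec n) 1).Nonempty
  · obtain ⟨x₀, hx₀, hmin⟩ :=
      (isCompact_sphere (0 : Vec n) 1).exists_isMinOn hne h.continuous.continuousOn
    have hx₀' : x₀ ≠ 0 := by
      rintro rfl
      simp at hx₀
    refine ⟨nrm x₀, lt_of_le_of_ne (h.nonneg _) fun h0 => hx₀' ((h.1 _).1 h0.symm), fun x => ?_⟩
    rcases eq_or_ne x 0 with rfl | hx
    · simp [h.zero]
    have hpos : 0 < ‖x‖ := norm_pos_iff.2 hx
    have hmem : ‖x‖⁻¹ • x ∈ Metric.sphere (0 : Vec n) 1 := by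
      rw [mem_sphere_zero_iff_norm, norm_smul, norm_inv, norm_norm, inv_mul_cancel₀ hpos.ne']
    have hle : nrm x₀ ≤ nrm (‖x‖⁻¹ • x) := hmin hmem
    rw [h.2.1, abs_of_pos (inv_pos.2 hpos), inv_mul_eq_div, le_div_iff₀ hpos] at hle
    exact hle
  · refine ⟨1, one_pos, fun x => ?_⟩
    rcases eq_or_ne x 0 with rfl | hx
    · simp [h.zero]
    refine absurd ⟨‖x‖⁻¹ • x, ?_⟩ hne
    rw [mem_sphere_zero_iff_norm, norm_smul, norm_inv, norm_norm,
      inv_mul_cancel₀ (norm_ne_zero_iff.2 hx)]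

lemma IsNorm.isCompact_unitBall (h : IsNorm nrm) : IsCompact {x | nrm x ≤ 1} := by
  obtain ⟨m, hm, hle⟩ := h.exists_mul_norm_le
  refine (isCompact_closedBall (0 : Vec n) (1 / m)).of_isClosed_subset
    (isClosed_le h.continuous continuous_const) fun x hx => ?_
  rw [mem_closedBall_zero_iff, le_div_iff₀ hm, mul_comm]
  exact (hle x).trans hx

/-- The supremum defining the dual norm is a maximum. -/
lemma IsNorm.exists_isGreatest_dualNorm (h : IsNorm nrm) (β : Vec n) :
    ∃ x, nrm x ≤ 1 ∧ dotp β x = dualNorm nrm β ∧ ∀ y, nrm y ≤ 1 → dotp β y ≤ dualNorm nrm β := by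
  obtain ⟨x, hx, hmax⟩ := h.isCompact_unitBall.exists_isMaxOn
    ⟨0, by simp [h.zero]⟩ (continuous_dotp β).continuousOn
  have hgreatest : IsGreatest {r | ∃ x, nrm x ≤ 1 ∧ r = dotp β x} (dotp β x) :=
    ⟨⟨x, hx, rfl⟩, by rintro _ ⟨y, hy, rfl⟩; exact hmax hy⟩
  have heq : dualNorm nrm β = dotp β x := hgreatest.csSup_eq
  exact ⟨x, hx, heq.symm, fun y hy => heq ▸ hmax hy⟩

lemma IsNorm.dualNorm_nonneg (h : IsNorm nrm) (β : Vec n) : 0 ≤ dualNorm nrm β := by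
  obtain ⟨x, -, -, hmax⟩ := h.exists_isGreatest_dualNorm β
  simpa [dotp_zero] using hmax 0 (by simp [h.zero])

lemma IsNorm.abs_dotp_le (h : IsNorm nrm) (β x : Vec n) :
    |dotp β x| ≤ dualNorm nrm β * nrm x := by
  have key : ∀ x, dotp β x ≤ dualNorm nrm β * nrm x := by
    intro x
    obtain ⟨-, -, -, hmax⟩ := h.exists_isGreatest_dualNorm β
    rcases eq_or_ne x 0 with rfl | hx
    · simp [h.zero, dotp_zero]
    have hpos : 0 < nrm x := lt_of_le_of_ne (h.nonneg x) fun h0 => hx ((h.1 x).1 h0.symm)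
    have := hmax ((nrm x)⁻¹ • x)
      (by rw [h.2.1, abs_of_pos (inv_pos.2 hpos), inv_mul_cancel₀ hpos.ne'])
    rwa [dotp_smul, inv_mul_eq_div, div_le_iff₀ hpos] at this
  have hneg := key (-x)
  rw [h.neg, ← neg_one_smul ℝ x, dotp_smul] at hneg
  rw [abs_le]
  constructor <;> linarith [key x]

/-- A direction dual to `β`; it vanishes when `β` has dual norm `0`. -/
lemma IsNorm.exists_dual_vector (h : IsNorm nrm) (β : Vec n) :
    ∃ v, dualNorm nrm β * nrm v ≤ 1 ∧ (dotp β v = 1 ∨ dualNorm nrm β = 0) := by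
  rcases eq_or_ne (dualNorm nrm β) 0 with h0 | h0
  · exact ⟨0, by simp [h0], Or.inr h0⟩
  obtain ⟨x, hx, heq, -⟩ := h.exists_isGreatest_dualNorm β
  have hpos : 0 < dualNorm nrm β := lt_of_le_of_ne (h.dualNorm_nonneg β) h0.symm
  refine ⟨(dualNorm nrm β)⁻¹ • x, ?_, Or.inl ?_⟩
  · rwa [h.2.1, abs_of_pos (inv_pos.2 hpos), mul_inv_cancel_left₀ h0]
  · rw [dotp_smul, heq, inv_mul_cancel₀ h0]

lemma IsNorm.measurable_xiCost (h : IsNorm nrm) :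
    Measurable fun z : (ℝ × Vec n) × (ℝ × Vec n) => xiCost nrm z.1 z.2 := by
  have := h.continuous.measurable
  unfold xiCost
  exact Measurable.ite (measurableSet_eq_fun (by fun_prop) (by fun_prop)) (by fun_prop)
    measurable_const

end Norm

lemma OnXi.ae {n : ℕ} {μ : Measure (ℝ × Vec n)} [IsProbabilityMeasure μ] (h : OnXi μ) :
    ∀ᵐ z ∂μ, |z.1| = 1 := by
  have hm : MeasurableSet {z : ℝ × Vec n | z.1 = 1 ∨ z.1 = -1} :=
    (measurable_fst (measurableSet_singleton _)).union (measurable_fst (measurableSet_singleton _))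
  have h' := (prob_compl_eq_zero_iff hm).2 h
  have h'' : ∀ᵐ z ∂μ, z.1 = 1 ∨ z.1 = -1 := h'
  filter_upwards [h''] with z hz
  rcases hz with hz | hz <;> simp [hz]

lemma onXi_of_ae {n : ℕ} {μ : Measure (ℝ × Vec n)} [IsProbabilityMeasure μ]
    (h : ∀ᵐ z ∂μ, |z.1| = 1) : OnXi μ := by
  have hm : MeasurableSet {z : ℝ × Vec n | z.1 = 1 ∨ z.1 = -1} :=
    (measurable_fst (measurableSet_singleton _)).union (measurable_fst (measurableSet_singleton _))
  refine (mem_ae_iff_prob_eq_one hm).1 ?_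
  filter_upwards [h] with z hz
  exact eq_or_eq_neg_of_abs_eq hz

section Projection

variable {n : ℕ} {nrm : Vec n → ℝ} {p : ℝ≥0∞} {ε : ℝ} {β : Vec n}

/-- The signed margin `y·β^⊤x` of a labelled point `(y, x)`. -/
def margin (β : Vec n) (z : ℝ × Vec n) : ℝ := z.1 * dotp β z.2

lemma measurable_margin (β : Vec n) : Measurable (margin β) := by
  have := (continuous_dotp β).measurable
  unfold margin
  fun_prop

lemma IsNorm.ofReal_abs_margin_sub_le (h : IsNorm nrm) (β : Vec n) {z₁ z₂ : ℝ × Vec n}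
    (hz : |z₂.1| = 1) :
    ENNReal.ofReal |margin β z₁ - margin β z₂| ≤
      (dualNorm nrm β).toNNReal * xiCost nrm z₁ z₂ := by
  have hD := h.dualNorm_nonneg β
  unfold xiCost margin
  split_ifs with heq
  · rw [← ENNReal.ofReal, ← ENNReal.ofReal_mul hD]
    refine ENNReal.ofReal_le_ofReal ?_
    rw [heq, ← mul_sub, abs_mul, hz, one_mul, ← dotp_sub]
    exact h.abs_dotp_le β _
  · rcases eq_or_ne (dualNorm nrm β) 0 with h0 | h0
    · have hdot : ∀ x, dotp β x = 0 := fun x => by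
        have := h.abs_dotp_le β x
        rw [h0, zero_mul] at this
        exact abs_nonpos_iff.1 this
      simp [hdot]
    · have : (dualNorm nrm β).toNNReal ≠ 0 := by
        rw [Ne, Real.toNNReal_eq_zero, not_le]
        exact lt_of_le_of_ne hD h0.symm
      rw [ENNReal.mul_top (by exact_mod_cast this)]
      exact le_top

/-- Push-forward along the signed margin is Lipschitz, with the dual norm of `β` as constant. -/
lemma IsNorm.wassersteinD_map_margin_le (h : IsNorm nrm) (hp : p ≠ 0) (β : Vec n)
    {F F₀ : Measure (ℝ × Vec n)} [IsProbabilityMeasure F] [IsProbabilityMeasure F₀]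
    (hF₀ : OnXi F₀) :
    WassersteinD (fun x y : ℝ => ENNReal.ofReal |x - y|) p (F.map (margin β))
        (F₀.map (margin β)) ≤
      (dualNorm nrm β).toNNReal * WassersteinD (xiCost nrm) p F F₀ := by
  have hT := measurable_margin β
  rw [WassersteinD_eq_iInf_eLpNorm _ hp, WassersteinD_eq_iInf_eLpNorm _ hp, iInf_subtype',
    iInf_subtype', ENNReal.mul_iInf' (by simp) fun _ => ⟨⟨_, prod_mem_couplings F F₀⟩⟩]
  refine le_iInf fun π => ?_
  obtain ⟨π, hπ, hfst, hsnd⟩ := π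
  have hTT : Measurable (Prod.map (margin β) (margin β)) := hT.prodMap hT
  have hmem : π.map (Prod.map (margin β) (margin β)) ∈
      Couplings (F.map (margin β)) (F₀.map (margin β)) := by
    refine ⟨Measure.isProbabilityMeasure_map hTT.aemeasurable, ?_, ?_⟩
    · rw [Measure.map_map measurable_fst hTT, ← hfst, Measure.map_map hT measurable_fst]
      rfl
    · rw [Measure.map_map measurable_snd hTT, ← hsnd, Measure.map_map hT measurable_snd]
      rfl
  refine (iInf_le _ ⟨_, hmem⟩).trans ?_
  have hm : Measurable fun z : ℝ × ℝ => ENNReal.ofReal |z.1 - z.2| :=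
    (continuous_abs.comp (continuous_fst.sub continuous_snd)).measurable.ennreal_ofReal
  rw [eLpNorm_map_measure hm.aestronglyMeasurable hTT.aemeasurable]
  refine eLpNorm_le_mul_eLpNorm_of_ae_le_mul' ?_ p
  have hlabel : ∀ᵐ z ∂π, |z.2.1| = 1 :=
    ae_of_ae_map measurable_snd.aemeasurable (hsnd.symm ▸ hF₀.ae)
  filter_upwards [hlabel] with z hz
  exact h.ofReal_abs_margin_sub_le β hz

lemma IsNorm.hasMomentP_map_margin (h : IsNorm nrm) (hp : p ≠ 0) (β : Vec n)
    {F : Measure (ℝ × Vec n)} [IsProbabilityMeasure F] (hF : OnXi F)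
    (hmom : HasMomentP (fun z => nrm z.2) p F) :
    HasMomentP (fun x : ℝ => |x|) p (F.map (margin β)) := by
  rw [hasMomentP_iff _ hp] at hmom ⊢
  have hm : Measurable fun x : ℝ => ENNReal.ofReal |x| :=
    continuous_abs.measurable.ennreal_ofReal
  rw [eLpNorm_map_measure hm.aestronglyMeasurable (measurable_margin β).aemeasurable]
  refine ne_top_of_le_ne_top (ENNReal.mul_ne_top ENNReal.coe_ne_top hmom)
    (eLpNorm_le_mul_eLpNorm_of_ae_le_mul' (c := (dualNorm nrm β).toNNReal) ?_ p)
  filter_upwards [hF.ae] with z hz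
  simp only [enorm_eq_self, Function.comp]
  rw [← ENNReal.ofReal, ← ENNReal.ofReal_mul (h.dualNorm_nonneg β)]
  refine ENNReal.ofReal_le_ofReal ?_
  rw [margin, abs_mul, hz, one_mul]
  exact h.abs_dotp_le β _

/-- Every distribution in the real Wasserstein ball is the signed-margin law of a distribution in
the ball on `Ξ`. -/
lemma IsNorm.exists_mem_wballXi_map_margin_eq (h : IsNorm nrm) (hp : 1 ≤ p) (hε : 0 ≤ ε)
    (β : Vec n) {F₀ : Measure (ℝ × Vec n)} [IsProbabilityMeasure F₀] (hXi : OnXi F₀)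
    (hmom : HasMomentP (fun z => nrm z.2) p F₀) {μ : Measure ℝ}
    (hμ : μ ∈ WballReal p (F₀.map (margin β)) (ε * dualNorm nrm β)) :
    ∃ F ∈ WballXi nrm p F₀ ε, F.map (margin β) = μ := by
  obtain ⟨hμp, -, hdist⟩ := hμ
  have hp0 : p ≠ 0 := (zero_lt_one.trans_le hp).ne'
  have hT := measurable_margin β
  have hD := h.dualNorm_nonneg β
  have hnm := h.continuous.measurable
  have : IsProbabilityMeasure (F₀.map (margin β)) :=
    Measure.isProbabilityMeasure_map hT.aemeasurable
  obtain ⟨π, ⟨hπ, hfst, hsnd⟩, hopt⟩ := exists_optimal_coupling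
    (c := fun z : ℝ × ℝ => |z.1 - z.2|.toNNReal) (by fun_prop) hp0 μ (F₀.map (margin β))
  obtain ⟨ρ, hρ, hρfst, hρπ⟩ := exists_lift_coupling hT F₀ π hsnd
  have hpair : Measurable fun w : (ℝ × Vec n) × ℝ => (w.2, margin β w.1) := by fun_prop
  have hcost : eLpNorm (fun w : (ℝ × Vec n) × ℝ => ENNReal.ofReal |w.2 - margin β w.1|) p ρ ≤
      ENNReal.ofReal (ε * dualNorm nrm β) := by
    refine le_trans (le_of_eq ?_) (hopt.le.trans hdist)
    have hm : Measurable fun z : ℝ × ℝ => ENNReal.ofReal |z.1 - z.2| :=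
      (continuous_abs.comp (continuous_fst.sub continuous_snd)).measurable.ennreal_ofReal
    rw [← hρπ]
    exact (eLpNorm_map_measure hm.aestronglyMeasurable hpair.aemeasurable).symm
  have hy : ∀ᵐ w ∂ρ, |w.1.1| = 1 :=
    ae_of_ae_map measurable_fst.aemeasurable (hρfst.symm ▸ hXi.ae)
  obtain ⟨v, hv, hβv⟩ := h.exists_dual_vector β
  set G : (ℝ × Vec n) × ℝ → ℝ × Vec n :=
    fun w => (w.1.1, w.1.2 + (w.1.1 * (w.2 - margin β w.1)) • v) with hGdef
  have hG : Measurable G := by fun_prop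
  have hFp : IsProbabilityMeasure (ρ.map G) := Measure.isProbabilityMeasure_map hG.aemeasurable
  have hshift : ∀ᵐ w ∂ρ, nrm ((w.1.1 * (w.2 - margin β w.1)) • v) =
      nrm v * |w.2 - margin β w.1| := by
    filter_upwards [hy] with w hw
    rw [h.2.1, abs_mul, hw, one_mul, mul_comm]
  have hshift_le : eLpNorm (fun w : (ℝ × Vec n) × ℝ =>
      ENNReal.ofReal (nrm ((w.1.1 * (w.2 - margin β w.1)) • v))) p ρ ≤ ENNReal.ofReal ε := by
    have h1 : eLpNorm (fun w : (ℝ × Vec n) × ℝ =>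
        ENNReal.ofReal (nrm ((w.1.1 * (w.2 - margin β w.1)) • v))) p ρ ≤
        (nrm v).toNNReal *
          eLpNorm (fun w : (ℝ × Vec n) × ℝ => ENNReal.ofReal |w.2 - margin β w.1|) p ρ := by
      refine eLpNorm_le_mul_eLpNorm_of_ae_le_mul' ?_ p
      filter_upwards [hshift] with w hw
      simp only [enorm_eq_self]
      rw [← ENNReal.ofReal, ← ENNReal.ofReal_mul (h.nonneg v), hw]
    refine h1.trans ((mul_le_mul_right hcost _).trans ?_)
    rw [← ENNReal.ofReal, ← ENNReal.ofReal_mul (h.nonneg v)]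
    refine ENNReal.ofReal_le_ofReal ?_
    calc nrm v * (ε * dualNorm nrm β) = ε * (dualNorm nrm β * nrm v) := by ring
      _ ≤ ε * 1 := by gcongr
      _ = ε := mul_one ε
  refine ⟨ρ.map G, ⟨hFp, ?_, ?_, ?_⟩, ?_⟩
  · refine onXi_of_ae ((ae_map_iff hG.aemeasurable ?_).2 hy)
    exact measurableSet_eq_fun (by fun_prop) measurable_const
  · rw [hasMomentP_iff _ hp0] at hmom ⊢
    have hm : Measurable fun z : ℝ × Vec n => ENNReal.ofReal (nrm z.2) := by fun_prop
    rw [eLpNorm_map_measure hm.aestronglyMeasurable hG.aemeasurable]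
    have hbase : eLpNorm (fun w : (ℝ × Vec n) × ℝ => ENNReal.ofReal (nrm w.1.2)) p ρ ≠ ∞ := by
      rw [← hρfst, eLpNorm_map_measure hm.aestronglyMeasurable measurable_fst.aemeasurable] at hmom
      exact hmom
    refine ne_top_of_le_ne_top (ENNReal.add_ne_top.2
      ⟨hbase, ne_top_of_le_ne_top ENNReal.ofReal_ne_top hshift_le⟩) ?_
    refine le_trans ?_ (eLpNorm_add_le (Measurable.aestronglyMeasurable (by fun_prop))
      (Measurable.aestronglyMeasurable (by fun_prop)) hp)
    refine eLpNorm_mono_enorm fun w => ?_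
    simp only [enorm_eq_self, Function.comp, Pi.add_apply]
    rw [← ENNReal.ofReal_add (h.nonneg _) (h.nonneg _)]
    exact ENNReal.ofReal_le_ofReal (h.2.2 _ _)
  · have hmem : ρ.map (fun w => (G w, w.1)) ∈ Couplings (ρ.map G) F₀ := by
      refine ⟨Measure.isProbabilityMeasure_map (by fun_prop), ?_, ?_⟩
      · rw [Measure.map_map measurable_fst (by fun_prop)]
        rfl
      · rw [Measure.map_map measurable_snd (by fun_prop), ← hρfst]
        rfl
    rw [WassersteinD_eq_iInf_eLpNorm _ hp0]
    refine (iInf₂_le _ hmem).trans (le_trans (le_of_eq ?_) hshift_le)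
    rw [eLpNorm_map_measure h.measurable_xiCost.aestronglyMeasurable (by fun_prop)]
    congr 1 with w
    simp [xiCost, hGdef]
  · have hae : margin β ∘ G =ᵐ[ρ] Prod.snd := by
      have hkey : ∀ᵐ w ∂ρ, (w.2 - margin β w.1) * dotp β v = w.2 - margin β w.1 := by
        rcases hβv with h1 | h0
        · simp [h1]
        · rw [h0, mul_zero, ENNReal.ofReal_zero, nonpos_iff_eq_zero,
            eLpNorm_eq_zero_iff (Measurable.aestronglyMeasurable (by fun_prop)) hp0] at hcost
          filter_upwards [hcost] with w hw
          have h0 : |w.2 - margin β w.1| ≤ 0 := by simpa using hw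
          rw [abs_nonpos_iff.1 h0, zero_mul]
      filter_upwards [hy, hkey] with w hw hk
      have hsq : w.1.1 * w.1.1 = 1 := by rw [← abs_mul_abs_self, hw, one_mul]
      calc margin β (G w)
          = margin β w.1 + (w.1.1 * w.1.1) * ((w.2 - margin β w.1) * dotp β v) := by
            simp only [hGdef, margin, dotp_add, dotp_smul]
            ring
        _ = w.2 := by rw [hsq, hk]; ring
    rw [Measure.map_map hT hG, Measure.map_congr hae, ← hfst, ← hρπ,
      Measure.map_map measurable_fst hpair]
    rfl

end Projection

/-- Theorem 2 of the paper, eq. (12): for `p ∈ [1,∞]`, `ε ≥ 0`, `β ∈ ℝⁿ`,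
and a Borel probability distribution `F₀` on `Ξ = {-1,1} × ℝⁿ` with finite `p`-th moment,
the set of laws of `Y·β^⊤X` as the law of `(Y,X)` ranges over `B̄_p(F₀,ε)` equals the
type-`p` Wasserstein ball (absolute-value norm on `ℝ`) `B_p(law of Y₀·β^⊤X₀, ε‖β‖_*)`. -/
theorem stmt1 {n : ℕ} (nrm : Vec n → ℝ) (hnrm : IsNorm nrm)
    (p : ℝ≥0∞) (hp : 1 ≤ p) (ε : ℝ) (hε : 0 ≤ ε) (β : Vec n)
    (F₀ : Measure (ℝ × Vec n)) (hF₀ : IsProbabilityMeasure F₀) (hXi : OnXi F₀)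
    (hmom : HasMomentP (fun z => nrm z.2) p F₀) :
    (fun F : Measure (ℝ × Vec n) => F.map (fun z : ℝ × Vec n => z.1 * dotp β z.2)) ''
        WballXi nrm p F₀ ε
      = WballReal p (F₀.map (fun z : ℝ × Vec n => z.1 * dotp β z.2))
          (ε * dualNorm nrm β) := by
  change (fun F : Measure (ℝ × Vec n) => F.map (margin β)) '' _ =
    WballReal p (F₀.map (margin β)) _
  have hp0 : p ≠ 0 := (zero_lt_one.trans_le hp).ne'
  apply Subset.antisymm
  · rintro _ ⟨F, ⟨hF, hFXi, hFmom, hdist⟩, rfl⟩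
    refine ⟨Measure.isProbabilityMeasure_map (measurable_margin β).aemeasurable,
      hnrm.hasMomentP_map_margin hp0 β hFXi hFmom, ?_⟩
    refine (hnrm.wassersteinD_map_margin_le hp0 β hXi).trans ?_
    rw [mul_comm ε, ENNReal.ofReal_mul (hnrm.dualNorm_nonneg β)]
    exact mul_le_mul_right hdist _
  · intro μ hμ
    exact hnrm.exists_mem_wballXi_map_margin_eq hp hε β hXi hmom hμ
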